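/- For every odd s with 1 ≤ s ≤ 2g−1 and every m with 1 ≤ m ≤ 2g, D_s(λ_{2m+2}) = 0 in B_g. Consequently each polynomial vector field D_s is projectable for the polynomial map ρ_g : ℂ^{3g} → ℂ^{2g} and its projection is zero. -/

import Mathlib

open MvPolynomial

noncomputable section

/-- B_g = ℂ[b_{i,j} : i ∈ {1,2,3}, j odd, 1 ≤ j ≤ 2g−1], as a polynomial ring in 3g variables;
the variable (i, m) : Fin 3 × Fin g stands for b_{i+1, 2m+1}. -/
abbrev Bg (g : ℕ) : Type := MvPolynomial (Fin 3 × Fin g) ℂ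

/-- `bb g i m` is the variable b_{i, 2m−1} (zero if i ∉ {1,2,3} or m ∉ {1,…,g}). -/
noncomputable def bb (g : ℕ) (i m : ℕ) : Bg g :=
  if h : 1 ≤ i ∧ i ≤ 3 ∧ 1 ≤ m ∧ m ≤ g then
    MvPolynomial.X (⟨i - 1, by omega⟩, ⟨m - 1, by omega⟩) else 0

/-- `bv g i j` is the variable b_{i,j} for odd j (zero for j > 2g−1). -/
noncomputable def bv (g : ℕ) (i j : ℕ) : Bg g :=
  if Odd j then bb g i ((j + 1) / 2) else 0

/-- `Qg g a c` is p_{2a−1, 2c−1} for 1 ≤ a ≤ c, by the elimination recursion. -/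
noncomputable def Qg (g : ℕ) : ℕ → ℕ → Bg g
  | 0, _ => 0
  | 1, c => 2 * bb g 1 c
  | 2, c => 6 * bb g 1 1 * bb g 1 c - bb g 3 c + 6 * bb g 1 (c + 1)
  | 3, c => bb g 3 1 * bb g 1 c - bb g 2 1 * bb g 2 c + bb g 1 1 * bb g 3 c
      - 2 * (4 * bb g 1 1 ^ 2 + bb g 1 2) * bb g 1 c
      + 10 * bb g 1 1 * bb g 1 (c + 1) - 2 * bb g 3 (c + 1) + 10 * bb g 1 (c + 2)
  | (a + 4), c => 2 * (if c + 1 ≤ g then Qg g (a + 3) (c + 1) else 0)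
      - (if c + 2 ≤ g then Qg g (a + 2) (c + 2) else 0)
      - 8 * bb g 1 1 * bb g 1 (a + 2) * bb g 1 c - 2 * bb g 1 c * bb g 1 (a + 3)
      - 2 * bb g 1 (a + 2) * bb g 1 (c + 1) + bb g 1 (a + 2) * bb g 3 c
      - bb g 2 (a + 2) * bb g 2 c + bb g 3 (a + 2) * bb g 1 c

/-- `pp g k l` is p_{k,l} for odd k, l (zero if k > 2g−1 or l > 2g−1). -/
noncomputable def pp (g : ℕ) (k l : ℕ) : Bg g :=
  if Odd k ∧ Odd l ∧ k ≤ 2 * g - 1 ∧ l ≤ 2 * g - 1 then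
    if k ≤ l then Qg g ((k + 1) / 2) ((l + 1) / 2) else Qg g ((l + 1) / 2) ((k + 1) / 2)
  else 0

/-- 𝐛ᵢ(ξ) = Σ_{m=1}^{g} b_{i,2m−1} ξᵐ ∈ B_g[ξ]. -/
noncomputable def Bcoef (g i : ℕ) : Polynomial (Bg g) :=
  ∑ m ∈ Finset.Icc 1 g, Polynomial.C (bb g i m) * Polynomial.X ^ m

/-- The polynomial ξ𝐛₂(ξ)² + 2ξ𝐛₃(ξ)(1 − 𝐛₁(ξ)) + 4(1 + 2b_{1,1}ξ)(1 − 𝐛₁(ξ))². -/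
noncomputable def Fg (g : ℕ) : Polynomial (Bg g) :=
  Polynomial.X * (Bcoef g 2) ^ 2 + 2 * Polynomial.X * Bcoef g 3 * (1 - Bcoef g 1)
    + 4 * (1 + 2 * Polynomial.C (bb g 1 1) * Polynomial.X) * (1 - Bcoef g 1) ^ 2

/-- `lam g m` is λ_{2m+2}, defined by 4λ_{2m+2} = coefficient of ξ^{m+1} in `Fg g`. -/
noncomputable def lam (g m : ℕ) : Bg g := ((1 : ℂ) / 4) • ((Fg g).coeff (m + 1))

/-- The polynomial vector field D₁ on B_g:
D₁(b_{1,j}) = b_{2,j}, D₁(b_{2,j}) = b_{3,j},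
D₁(b_{3,j}) = 4(2b_{1,1}b_{2,j} + b_{2,1}b_{1,j} + b_{2,j+2}) (with b_{2,2g+1} = 0). -/
noncomputable def D1g (g : ℕ) : Derivation ℂ (Bg g) (Bg g) :=
  MvPolynomial.mkDerivation ℂ (fun v : Fin 3 × Fin g =>
    if (v.1 : ℕ) = 0 then bb g 2 ((v.2 : ℕ) + 1)
    else if (v.1 : ℕ) = 1 then bb g 3 ((v.2 : ℕ) + 1)
    else 4 * (2 * bb g 1 1 * bb g 2 ((v.2 : ℕ) + 1) + bb g 2 1 * bb g 1 ((v.2 : ℕ) + 1)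
      + bb g 2 ((v.2 : ℕ) + 2)))

/-- The polynomial vector field D_s on B_g (for odd s ≥ 3):
D_s(b_{i,j}) = (1/2)·D₁ⁱ(p_{s,j}); for s = 1 it is D₁.  (For s = 2g+1 the
conventions p_{s,j} = 0 make it the zero vector field.) -/
noncomputable def Dsg (g s : ℕ) : Derivation ℂ (Bg g) (Bg g) :=
  if s = 1 then D1g g else
  MvPolynomial.mkDerivation ℂ (fun v : Fin 3 × Fin g =>
    ((1 : ℂ) / 2) • (((D1g g).toLinearMap ^ ((v.1 : ℕ) + 1)) (pp g s (2 * (v.2 : ℕ) + 1))))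

/-- The multiplication operator by c ∈ B_g. -/
noncomputable def mulBg (g : ℕ) (c : Bg g) : Module.End ℂ (Bg g) := LinearMap.mulLeft ℂ c

/-- D_s as a ℂ-linear endomorphism of B_g. -/
noncomputable def DLg (g s : ℕ) : Module.End ℂ (Bg g) := (Dsg g s).toLinearMap

/-- ℒ = D₁² − 2b_{1,1}. -/
noncomputable def Lg (g : ℕ) : Module.End ℂ (Bg g) := DLg g 1 ^ 2 - mulBg g (2 * bb g 1 1)

/-- The Buchstaber–Shorina polynomial differential operator
ℬ_{2k+1} = D_{2k−1}D₁² − (b_{1,1}D_{2k−1} + D_{2k−1}b_{1,1})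
  − (1/2)(b_{1,2k−1}D₁ + D₁b_{1,2k−1}) − D_{2k+1}. -/
noncomputable def Bopg (g k : ℕ) : Module.End ℂ (Bg g) :=
  DLg g (2 * k - 1) * DLg g 1 ^ 2
    - (mulBg g (bb g 1 1) * DLg g (2 * k - 1) + DLg g (2 * k - 1) * mulBg g (bb g 1 1))
    - ((1 : ℂ) / 2) • (mulBg g (bv g 1 (2 * k - 1)) * DLg g 1 + DLg g 1 * mulBg g (bv g 1 (2 * k - 1)))
    - DLg g (2 * k + 1)

theorem bb_zero (g i : ℕ) : bb g i 0 = 0 := by simp [bb]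

theorem bb_of_lt {g m : ℕ} (i : ℕ) (h : g < m) : bb g i m = 0 := by
  rw [bb, dif_neg]; omega

theorem D1g_bb_one (g m : ℕ) : D1g g (bb g 1 m) = bb g 2 m := by
  by_cases h : 1 ≤ m ∧ m ≤ g
  · have e : m - 1 + 1 = m := by omega
    rw [bb, dif_pos (by omega), D1g, mkDerivation_X]
    simp [e]
  · rw [bb, dif_neg (by omega), bb, dif_neg (by omega), map_zero]

theorem D1g_bb_two (g m : ℕ) : D1g g (bb g 2 m) = bb g 3 m := by
  by_cases h : 1 ≤ m ∧ m ≤ g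
  · have e : m - 1 + 1 = m := by omega
    rw [bb, dif_pos (by omega), D1g, mkDerivation_X]
    simp [e]
  · rw [bb, dif_neg (by omega), bb, dif_neg (by omega), map_zero]

theorem D1g_bb_three (g : ℕ) {m : ℕ} (hm : 1 ≤ m) : D1g g (bb g 3 m) =
    4 * (2 * bb g 1 1 * bb g 2 m + bb g 2 1 * bb g 1 m + bb g 2 (m + 1)) := by
  by_cases h : m ≤ g
  · have e : m - 1 + 1 = m := by omega
    have e' : m - 1 + 2 = m + 1 := by omega
    rw [bb, dif_pos (by omega), D1g, mkDerivation_X]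
    simp [e, e']
  · simp [bb_of_lt _ (show g < m by omega), bb_of_lt _ (show g < m + 1 by omega)]

/-- The coefficients of 1 − 𝐛₁(ξ). -/
noncomputable def ucoef (g n : ℕ) : Bg g := (if n = 0 then 1 else 0) - bb g 1 n

theorem ucoef_zero (g : ℕ) : ucoef g 0 = 1 := by simp [ucoef, bb_zero]

theorem ucoef_pos (g : ℕ) {n : ℕ} (hn : 1 ≤ n) : ucoef g n = -bb g 1 n := by
  simp [ucoef, show n ≠ 0 by omega]

/-- The Wronskian-type coefficients of u(ξ) D₁u(η) − D₁u(ξ) u(η), where u = 1 − 𝐛₁. -/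
noncomputable def wcoef (g i j : ℕ) : Bg g := bb g 2 i * ucoef g j - ucoef g i * bb g 2 j

theorem wcoef_antisymm (g i j : ℕ) : wcoef g i j = -wcoef g j i := by
  simp only [wcoef]; ring

/-- The coefficients of ξη (u(ξ) D₁u(η) − D₁u(ξ) u(η)) / (η − ξ), where u = 1 − 𝐛₁. -/
noncomputable def divcoef (g a c : ℕ) : Bg g :=
  ∑ i ∈ Finset.range a, wcoef g i (a + c - 1 - i)

theorem divcoef_succ (g a c : ℕ) : divcoef g (a + 1) c = divcoef g a (c + 1) + wcoef g a c := by
  have hi (i : ℕ) : a + 1 + c - 1 - i = a + (c + 1) - 1 - i := by omega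
  simp only [divcoef, Finset.sum_range_succ, hi]
  rw [show a + (c + 1) - 1 - a = c by omega]

theorem divcoef_zero_left (g c : ℕ) : divcoef g 0 c = 0 := by simp [divcoef]

theorem divcoef_zero_right (g a : ℕ) : divcoef g a 0 = 0 := by
  have h : divcoef g a 0 = -divcoef g a 0 := by
    conv_lhs => rw [divcoef, ← Finset.sum_range_reflect]
    rw [divcoef, ← Finset.sum_neg_distrib]
    refine Finset.sum_congr rfl fun i hi => ?_
    have := Finset.mem_range.1 hi
    rw [wcoef_antisymm]
    congr 2
    omega
  exact CharZero.eq_neg_self_iff.1 h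

theorem divcoef_comm (g a c : ℕ) : divcoef g a c = divcoef g c a := by
  induction a generalizing c with
  | zero => rw [divcoef_zero_left, divcoef_zero_right]
  | succ a ih =>
    rw [divcoef_succ, ih, divcoef_succ, wcoef_antisymm g c a]; ring

theorem divcoef_of_lt {g c : ℕ} (a : ℕ) (hc : g < c) : divcoef g a c = 0 := by
  refine Finset.sum_eq_zero fun i hi => ?_
  have := Finset.mem_range.1 hi
  have hlt : g < a + c - 1 - i := by omega
  simp [wcoef, ucoef_pos g (show 1 ≤ a + c - 1 - i by omega), bb_of_lt _ hlt]

theorem Qg_of_lt {g c : ℕ} (a : ℕ) (hc : g < c) : Qg g a c = 0 := by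
  match a with
  | 0 => simp [Qg]
  | 1 | 2 | 3 =>
    simp [Qg, bb_of_lt _ hc, bb_of_lt _ (show g < c + 1 by omega),
      bb_of_lt _ (show g < c + 2 by omega)]
  | a + 4 =>
    simp [Qg, bb_of_lt _ hc, bb_of_lt _ (show g < c + 1 by omega),
      show ¬ c + 1 ≤ g by omega, show ¬ c + 2 ≤ g by omega]

theorem Qg_add_four (g a c : ℕ) : Qg g (a + 4) c =
    2 * Qg g (a + 3) (c + 1) - Qg g (a + 2) (c + 2)
      - 8 * bb g 1 1 * bb g 1 (a + 2) * bb g 1 c - 2 * bb g 1 c * bb g 1 (a + 3)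
      - 2 * bb g 1 (a + 2) * bb g 1 (c + 1) + bb g 1 (a + 2) * bb g 3 c
      - bb g 2 (a + 2) * bb g 2 c + bb g 3 (a + 2) * bb g 1 c := by
  have h₁ : (if c + 1 ≤ g then Qg g (a + 3) (c + 1) else 0) = Qg g (a + 3) (c + 1) :=
    ite_eq_left_iff.2 fun h => (Qg_of_lt _ (by omega)).symm
  have h₂ : (if c + 2 ≤ g then Qg g (a + 2) (c + 2) else 0) = Qg g (a + 2) (c + 2) :=
    ite_eq_left_iff.2 fun h => (Qg_of_lt _ (by omega)).symm
  rw [Qg, h₁, h₂]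

theorem D1g_ofNat (g n : ℕ) [n.AtLeastTwo] : D1g g (ofNat(n) : Bg g) = 0 :=
  (D1g g).map_natCast n

theorem D1g_mul (g : ℕ) (x y : Bg g) : D1g g (x * y) = D1g g x * y + x * D1g g y := by
  rw [Derivation.leibniz, smul_eq_mul, smul_eq_mul]; ring

theorem D1g_Qg (g a : ℕ) {c : ℕ} (hc : 1 ≤ c) : D1g g (Qg g a c) = -2 * divcoef g a c := by
  induction a using Nat.strong_induction_on generalizing c with
  | _ a ih =>
    match a with
    | 0 => simp [Qg, divcoef_zero_left]
    | 1 =>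
      simp only [Qg, divcoef_succ, divcoef_zero_left, D1g_mul, D1g_ofNat, D1g_bb_one,
        wcoef, bb_zero, ucoef_zero]
      ring
    | 2 =>
      simp only [Qg, divcoef_succ, divcoef_zero_left, map_sub, map_add, D1g_mul, D1g_ofNat,
        D1g_bb_one, D1g_bb_three g hc, wcoef, bb_zero, ucoef_zero, ucoef_pos g hc,
        ucoef_pos g le_rfl, zero_add, mul_assoc]
      ring
    | 3 =>
      simp only [Qg, divcoef_succ, divcoef_zero_left, map_sub, map_add, D1g_mul, D1g_ofNat,
        D1g_bb_one, D1g_bb_two, D1g_bb_three g hc, D1g_bb_three g le_rfl,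
        D1g_bb_three g (show 1 ≤ c + 1 by omega), wcoef, bb_zero, ucoef_zero, ucoef_pos g hc,
        ucoef_pos g le_rfl, ucoef_pos g (show 1 ≤ c + 1 by omega),
        ucoef_pos g (show 1 ≤ 1 + 1 by omega), zero_add, mul_assoc, sq, one_add_one_eq_two,
        add_assoc]
      ring
    | a + 4 =>
      have h₃ := ih (a + 3) (by omega) (show 1 ≤ c + 1 by omega)
      have h₂ := ih (a + 2) (by omega) (show 1 ≤ c + 2 by omega)
      rw [divcoef_succ g (a + 2) (c + 1)] at h₃
      rw [Qg_add_four, divcoef_succ g (a + 3) c, divcoef_succ g (a + 2) (c + 1)]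
      simp only [map_sub, map_add, D1g_mul, D1g_ofNat, D1g_bb_one, D1g_bb_two,
        D1g_bb_three g hc, D1g_bb_three g (show 1 ≤ a + 2 by omega), h₂, h₃, wcoef,
        ucoef_pos g hc, ucoef_pos g (show 1 ≤ c + 1 by omega),
        ucoef_pos g (show 1 ≤ a + 2 by omega), ucoef_pos g (show 1 ≤ a + 2 + 1 by omega),
        mul_assoc]
      ring

theorem D1g_pp {g a c : ℕ} (ha : 1 ≤ a) (hag : a ≤ g) (hc : 1 ≤ c) (hcg : c ≤ g) :
    D1g g (pp g (2 * a - 1) (2 * c - 1)) = -2 * divcoef g a c := by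
  have hodd : Odd (2 * a - 1) ∧ Odd (2 * c - 1) ∧ 2 * a - 1 ≤ 2 * g - 1 ∧
      2 * c - 1 ≤ 2 * g - 1 :=
    ⟨⟨a - 1, by omega⟩, ⟨c - 1, by omega⟩, by omega, by omega⟩
  rw [pp, if_pos hodd, show (2 * a - 1 + 1) / 2 = a by omega,
    show (2 * c - 1 + 1) / 2 = c by omega]
  split_ifs
  · exact D1g_Qg g a hc
  · rw [D1g_Qg g c ha, divcoef_comm]

theorem Dsg_X {g s : ℕ} (hs : s ≠ 1) (v : Fin 3 × Fin g) : Dsg g s (X v) =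
    ((1 : ℂ) / 2) • (((D1g g).toLinearMap ^ ((v.1 : ℕ) + 1)) (pp g s (2 * (v.2 : ℕ) + 1))) := by
  rw [Dsg, if_neg hs, mkDerivation_X]

theorem Dsg_one (g : ℕ) : Dsg g 1 = D1g g := if_pos rfl

theorem Dsg_ucoef {g n : ℕ} (hn : 1 ≤ n) (hng : n ≤ g) (c : ℕ) :
    Dsg g (2 * n - 1) (ucoef g c) = divcoef g n c := by
  have hhalf (x : Bg g) : ((1 : ℂ) / 2) • (2 * x) = x := by
    rw [two_mul, ← two_smul ℂ x, smul_smul]; norm_num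
  have hu : Dsg g (2 * n - 1) (ucoef g c) = -Dsg g (2 * n - 1) (bb g 1 c) := by
    rw [ucoef]; split_ifs <;> simp
  rw [hu]
  by_cases hc : 1 ≤ c ∧ c ≤ g
  · by_cases h1 : n = 1
    · subst h1
      rw [show 2 * 1 - 1 = 1 from rfl, Dsg_one, D1g_bb_one, divcoef_succ]
      simp [divcoef_zero_left, wcoef, bb_zero, ucoef_zero]
    · rw [bb, dif_pos (by omega), Dsg_X (by omega)]
      have e : 2 * (c - 1) + 1 = 2 * c - 1 := by omega
      have h := D1g_pp hn hng hc.1 hc.2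
      simp only [Nat.sub_self, zero_add, pow_one, e, Derivation.coeFn_coe, h]
      rw [neg_mul, smul_neg, neg_neg, hhalf]
  · rcases Nat.eq_zero_or_pos c with rfl | hpos
    · rw [bb_zero, divcoef_zero_right, map_zero, neg_zero]
    · rw [bb_of_lt _ (by omega), divcoef_of_lt n (by omega), map_zero, neg_zero]

theorem Dsg_bb_succ {g s i : ℕ} (hi : i = 1 ∨ i = 2) (c : ℕ) :
    Dsg g s (bb g (i + 1) c) = D1g g (Dsg g s (bb g i c)) := by
  by_cases h1 : s = 1
  · subst h1
    rw [Dsg_one]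
    rcases hi with rfl | rfl
    · rw [D1g_bb_one]
    · simp only [D1g_bb_two]
  · by_cases hc : 1 ≤ c ∧ c ≤ g
    · have e : i - 1 + 1 = i := by omega
      rw [bb, dif_pos (by omega), Dsg_X h1, bb, dif_pos (by omega), Dsg_X h1]
      simp only [Nat.add_sub_cancel, e, Derivation.map_smul, pow_succ', Module.End.mul_apply,
        Derivation.coeFn_coe]
    · rw [bb, dif_neg (by omega), bb, dif_neg (by omega)]; simp

theorem Dsg_bb_one_one {g n : ℕ} (hn : 1 ≤ n) (hng : n ≤ g) :
    Dsg g (2 * n - 1) (bb g 1 1) = bb g 2 n := by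
  have h := Dsg_ucoef hn hng 1
  rw [divcoef_comm, divcoef_succ, ucoef_pos g le_rfl, map_neg, divcoef_zero_left, wcoef, bb_zero,
    ucoef_zero] at h
  linear_combination -h

theorem coeff_Bcoef (g i n : ℕ) : (Bcoef g i).coeff n = bb g i n := by
  simp only [Bcoef, Polynomial.finsetSum_coeff, Polynomial.coeff_C_mul, Polynomial.coeff_X_pow,
    mul_ite, mul_one, mul_zero, Finset.sum_ite_eq, Finset.mem_Icc]
  split_ifs with h
  · rfl
  · rcases Nat.eq_zero_or_pos n with rfl | hpos
    · rw [bb_zero]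
    · rw [bb_of_lt _ (by omega)]

theorem coeff_one_sub_Bcoef (g n : ℕ) : (1 - Bcoef g 1).coeff n = ucoef g n := by
  rw [Polynomial.coeff_sub, Polynomial.coeff_one, coeff_Bcoef, ucoef]

/-- A derivation of B_g, acting coefficientwise on polynomials. -/
noncomputable def coeffDer (g : ℕ) (D : Derivation ℂ (Bg g) (Bg g)) :
    Derivation ℂ (Polynomial (Bg g)) (Polynomial (Bg g)) :=
  (PolynomialModule.equivPolynomialSelf (R := Bg g)).toLinearMap.compDer D.mapCoeffs

theorem coeff_coeffDer (g : ℕ) (D : Derivation ℂ (Bg g) (Bg g)) (p : Polynomial (Bg g)) (n : ℕ) :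
    (coeffDer g D p).coeff n = D (p.coeff n) := rfl

theorem coeffDer_C (g : ℕ) (D : Derivation ℂ (Bg g) (Bg g)) (x : Bg g) :
    coeffDer g D (Polynomial.C x) = Polynomial.C (D x) := by
  ext1 n
  rw [coeff_coeffDer, Polynomial.coeff_C, Polynomial.coeff_C]
  split_ifs <;> simp

theorem coeffDer_X (g : ℕ) (D : Derivation ℂ (Bg g) (Bg g)) :
    coeffDer g D Polynomial.X = 0 := by
  ext1 n
  rw [coeff_coeffDer, Polynomial.coeff_X]
  split_ifs <;> simp

theorem coeffDer_mul (g : ℕ) (D : Derivation ℂ (Bg g) (Bg g)) (p q : Polynomial (Bg g)) :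
    coeffDer g D (p * q) = coeffDer g D p * q + p * coeffDer g D q := by
  rw [Derivation.leibniz, smul_eq_mul, smul_eq_mul]; ring

theorem coeffDer_ofNat (g n : ℕ) [n.AtLeastTwo] (D : Derivation ℂ (Bg g) (Bg g)) :
    coeffDer g D (ofNat(n) : Polynomial (Bg g)) = 0 :=
  (coeffDer g D).map_natCast n

theorem coeffDer_D1g_Bcoef_one (g : ℕ) : coeffDer g (D1g g) (Bcoef g 1) = Bcoef g 2 := by
  ext1 n; simp only [coeff_coeffDer, coeff_Bcoef, D1g_bb_one]

theorem coeffDer_D1g_Bcoef_two (g : ℕ) : coeffDer g (D1g g) (Bcoef g 2) = Bcoef g 3 := by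
  ext1 n; simp only [coeff_coeffDer, coeff_Bcoef, D1g_bb_two]

theorem X_mul_coeffDer_D1g_Bcoef_three (g : ℕ) :
    Polynomial.X * coeffDer g (D1g g) (Bcoef g 3) =
      4 * (2 * Polynomial.C (bb g 1 1) * Polynomial.X * Bcoef g 2
        - Polynomial.C (bb g 2 1) * Polynomial.X * (1 - Bcoef g 1) + Bcoef g 2) := by
  have h4 (p : Polynomial (Bg g)) : 4 * p = Polynomial.C 4 * p := by
    rw [map_ofNat Polynomial.C]
  have h2 (p : Polynomial (Bg g)) : 2 * p = Polynomial.C 2 * p := by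
    rw [map_ofNat Polynomial.C]
  ext1 n
  rw [h4, h2]
  rcases n with _ | n
  · simp [coeff_Bcoef, bb_zero, Polynomial.mul_coeff_zero]
  · simp only [Polynomial.coeff_C_mul, Polynomial.coeff_add, Polynomial.coeff_sub, mul_assoc,
      Polynomial.coeff_X_mul, coeff_coeffDer, coeff_Bcoef, Polynomial.coeff_one]
    rcases n with _ | n
    · simp [bb_zero]
    · rw [D1g_bb_three g (Nat.succ_pos n)]
      simp; ring

/-- The effect on ξ𝐛₂² + 2ξ𝐛₃(1 − 𝐛₁) + 4(1 + 2b_{1,1}ξ)(1 − 𝐛₁)² of a derivation commuting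
with D₁, in terms of its value V on 1 − 𝐛₁. -/
theorem coeffDer_Fg {g n : ℕ} (hn : 1 ≤ n) (hng : n ≤ g) (V : Polynomial (Bg g))
    (hV : coeffDer g (Dsg g (2 * n - 1)) (Bcoef g 1) = -V) :
    coeffDer g (Dsg g (2 * n - 1)) (Fg g) =
      -2 * Polynomial.X * Bcoef g 2 * coeffDer g (D1g g) V
      - 2 * Polynomial.X * coeffDer g (D1g g) (coeffDer g (D1g g) V) * (1 - Bcoef g 1)
      + 2 * Polynomial.X * Bcoef g 3 * V
      + 8 * Polynomial.C (bb g 2 n) * Polynomial.X * (1 - Bcoef g 1) ^ 2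
      + 8 * (1 + 2 * Polynomial.C (bb g 1 1) * Polynomial.X) * (1 - Bcoef g 1) * V := by
  have hcomm {i : ℕ} (hi : i = 1 ∨ i = 2) : coeffDer g (Dsg g (2 * n - 1)) (Bcoef g (i + 1)) =
      coeffDer g (D1g g) (coeffDer g (Dsg g (2 * n - 1)) (Bcoef g i)) := by
    ext1 c; simp only [coeff_coeffDer, coeff_Bcoef, Dsg_bb_succ hi]
  have h2 := hcomm (Or.inl rfl)
  have h3 := hcomm (Or.inr rfl)
  rw [hV, map_neg] at h2
  rw [h2, map_neg] at h3
  simp only [Fg, sq, map_add, map_sub, coeffDer_mul, coeffDer_X, coeffDer_C, coeffDer_ofNat,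
    Derivation.map_one_eq_zero, Dsg_bb_one_one hn hng, hV, h2, h3]
  ring

theorem X_mul_coeffDer_one_sub_Bcoef {g n : ℕ} (hn : 1 ≤ n) (hng : n + 1 ≤ g) :
    Polynomial.X * coeffDer g (Dsg g (2 * (n + 1) - 1)) (1 - Bcoef g 1) =
      coeffDer g (Dsg g (2 * n - 1)) (1 - Bcoef g 1)
      + Polynomial.X * (Bcoef g 2 * Polynomial.C (bb g 1 n)
        + (1 - Bcoef g 1) * Polynomial.C (bb g 2 n)) := by
  ext1 c
  rcases c with _ | c
  · simp [coeff_coeffDer, coeff_one_sub_Bcoef, Dsg_ucoef hn (by omega : n ≤ g),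
      divcoef_zero_right, -map_sub, -Polynomial.coeff_sub]
  · simp only [Polynomial.coeff_add, Polynomial.coeff_X_mul, Polynomial.coeff_mul_C,
      coeff_coeffDer, coeff_one_sub_Bcoef, Dsg_ucoef hn (by omega : n ≤ g),
      Dsg_ucoef (by omega : 1 ≤ n + 1) hng, divcoef_succ, coeff_Bcoef, wcoef, ucoef_pos g hn]
    ring

theorem coeffDer_one_Fg {g : ℕ} (hg : 1 ≤ g) : coeffDer g (Dsg g 1) (Fg g) = 0 := by
  have hV : coeffDer g (Dsg g (2 * 1 - 1)) (Bcoef g 1) = -(-Bcoef g 2) := by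
    rw [show 2 * 1 - 1 = 1 from rfl, Dsg_one, coeffDer_D1g_Bcoef_one, neg_neg]
  have h3 := X_mul_coeffDer_D1g_Bcoef_three g
  have h := coeffDer_Fg le_rfl hg _ hV
  simp only [map_neg, coeffDer_D1g_Bcoef_two] at h
  rw [show 2 * 1 - 1 = 1 from rfl] at h
  linear_combination h + 2 * (1 - Bcoef g 1) * h3

theorem coeffDer_Fg_eq_zero {g n : ℕ} (hn : 1 ≤ n) (hng : n ≤ g) :
    coeffDer g (Dsg g (2 * n - 1)) (Fg g) = 0 := by
  induction n, hn using Nat.le_induction with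
  | base => exact coeffDer_one_Fg hng
  | succ n hn ih =>
    have hng' : n ≤ g := by omega
    have key := X_mul_coeffDer_one_sub_Bcoef hn hng
    have hV (k : ℕ) : coeffDer g (Dsg g (2 * k - 1)) (Bcoef g 1) =
        -coeffDer g (Dsg g (2 * k - 1)) (1 - Bcoef g 1) := by simp
    have h := coeffDer_Fg hn hng' _ (hV n)
    have h' := coeffDer_Fg (by omega) hng _ (hV (n + 1))
    generalize coeffDer g (Dsg g (2 * n - 1)) (1 - Bcoef g 1) = V at key h
    generalize coeffDer g (Dsg g (2 * (n + 1) - 1)) (1 - Bcoef g 1) = V' at key h'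
    have key₁ := congrArg (coeffDer g (D1g g)) key
    simp only [map_add, map_sub, coeffDer_mul, coeffDer_X, coeffDer_C, D1g_bb_one, D1g_bb_two,
      Derivation.map_one_eq_zero, coeffDer_D1g_Bcoef_one, coeffDer_D1g_Bcoef_two] at key₁
    have key₂ := congrArg (coeffDer g (D1g g)) key₁
    simp only [map_add, map_sub, coeffDer_mul, coeffDer_X, coeffDer_C, D1g_bb_one, D1g_bb_two,
      Derivation.map_one_eq_zero, coeffDer_D1g_Bcoef_one, coeffDer_D1g_Bcoef_two,
      D1g_bb_three g hn, map_zero] at key₂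
    have h3 := X_mul_coeffDer_D1g_Bcoef_three g
    have hC : Polynomial.C (4 * (2 * bb g 1 1 * bb g 2 n + bb g 2 1 * bb g 1 n + bb g 2 (n + 1))) =
        4 * (2 * Polynomial.C (bb g 1 1) * Polynomial.C (bb g 2 n)
          + Polynomial.C (bb g 2 1) * Polynomial.C (bb g 1 n) + Polynomial.C (bb g 2 (n + 1))) := by
      simp only [map_mul, map_add, map_ofNat Polynomial.C]
    rw [hC] at key₂
    rw [ih hng'] at h
    have hX : Polynomial.X * coeffDer g (Dsg g (2 * (n + 1) - 1)) (Fg g) = 0 := by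
      rw [h']
      linear_combination (-2 * Polynomial.X * Bcoef g 2) * key₁
        - 2 * Polynomial.X * (1 - Bcoef g 1) * key₂ + 2 * Polynomial.X * Bcoef g 3 * key
        + 8 * (1 + 2 * Polynomial.C (bb g 1 1) * Polynomial.X) * (1 - Bcoef g 1) * key
        - 2 * Polynomial.X * (1 - Bcoef g 1) * Polynomial.C (bb g 1 n) * h3 - h
    exact (mul_eq_zero.1 hX).resolve_left Polynomial.X_ne_zero

/-- D_s(λ_{2m+2}) = 0 in B_g for every odd s with 1 ≤ s ≤ 2g−1 and every
1 ≤ m ≤ 2g; consequently each D_s is projectable for ρ_g with zero projection. -/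
theorem stmt6 (g : ℕ) (hg : 1 ≤ g) :
    ∀ s, Odd s → 1 ≤ s → s ≤ 2 * g - 1 →
      ∀ m, 1 ≤ m → m ≤ 2 * g → Dsg g s (lam g m) = 0 := by
  rintro s ⟨k, rfl⟩ - hs m - -
  have h := coeffDer_Fg_eq_zero (g := g) (n := k + 1) (by omega) (by omega)
  rw [show 2 * (k + 1) - 1 = 2 * k + 1 by omega] at h
  rw [lam, Derivation.map_smul, ← coeff_coeffDer, h, Polynomial.coeff_zero, smul_zero]

end
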